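/- arXiv:2604.22385 — 3 statements merged into one kernel-verified Lean document; each statement's English description precedes it below -/
import Mathlib

section
/- Let K0 : ℝ → ℝ satisfy 0 ≤ K0(x) ≤ C for all x and |K0(x) − K0(y)| ≤ C''|x − y|^ε for all x, y ∈ ℝ, with ε ∈ (0,1], and let K be its d-dimensional product kernel. Let f : ℝ^d → ℝ satisfy 0 ≤ f ≤ c, let X_1, …, X_N ∈ [0,A]^d be arbitrary points, let h > 0, and define f̂(x) = (A^d/(N h^d)) ∑_{i=1}^N f(X_i) K((X_i − x)/h). Then for all x, y ∈ ℝ^d, |f̂(x) − f̂(y)| ≤ c A^d d C^{d−1} C'' h^{−d−ε} ‖x − y‖₂^ε. -/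
open Real

noncomputable section

/-- The hypercube `[0,A]^d` in `ℝ^d`. -/
def cube (d : ℕ) (A : ℝ) : Set (EuclideanSpace ℝ (Fin d)) :=
  {x | ∀ i, x i ∈ Set.Icc (0 : ℝ) A}

/-- The kernel regression estimate built from `N` sample points. -/
def kernEst (d N : ℕ) (A h : ℝ) (K0 : ℝ → ℝ) (f : EuclideanSpace ℝ (Fin d) → ℝ)
    (Xs : Fin N → EuclideanSpace ℝ (Fin d)) (x : EuclideanSpace ℝ (Fin d)) : ℝ :=
  A ^ d / (N * h ^ d) * ∑ i, f (Xs i) * ∏ j, K0 ((h⁻¹ • (Xs i - x)) j)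

/-- Products of factors in `[0, C]` are Lipschitz in each factor, with constant `C ^ (n - 1)`. -/
theorem abs_prod_sub_prod_mul_le {ι : Type*} (s : Finset ι) (a b : ι → ℝ) {C : ℝ} (hC : 0 ≤ C)
    (ha0 : ∀ i, 0 ≤ a i) (ha : ∀ i, a i ≤ C) (hb0 : ∀ i, 0 ≤ b i) (hb : ∀ i, b i ≤ C) :
    |∏ i ∈ s, a i - ∏ i ∈ s, b i| * C ≤ C ^ s.card * ∑ i ∈ s, |a i - b i| := by
  classical
  induction s using Finset.induction_on with
  | empty => simp
  | insert j s hj ih =>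
    rw [Finset.prod_insert hj, Finset.prod_insert hj, Finset.sum_insert hj,
      Finset.card_insert_of_notMem hj]
    have hP0 : 0 ≤ ∏ i ∈ s, a i := Finset.prod_nonneg fun i _ => ha0 i
    have hP : ∏ i ∈ s, a i ≤ C ^ s.card :=
      (Finset.prod_le_prod (fun i _ => ha0 i) fun i _ => ha i).trans_eq (Finset.prod_const C)
    calc |a j * ∏ i ∈ s, a i - b j * ∏ i ∈ s, b i| * C
        = |(a j - b j) * ∏ i ∈ s, a i + b j * (∏ i ∈ s, a i - ∏ i ∈ s, b i)| * C := by
          congr 2; ring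
      _ ≤ (|a j - b j| * ∏ i ∈ s, a i + b j * |∏ i ∈ s, a i - ∏ i ∈ s, b i|) * C := by
          gcongr
          refine (abs_add_le _ _).trans_eq ?_
          rw [abs_mul, abs_mul, abs_of_nonneg hP0, abs_of_nonneg (hb0 j)]
      _ = |a j - b j| * (∏ i ∈ s, a i) * C + b j * (|∏ i ∈ s, a i - ∏ i ∈ s, b i| * C) := by ring
      _ ≤ |a j - b j| * C ^ s.card * C + C * (C ^ s.card * ∑ i ∈ s, |a i - b i|) := by
          gcongr
          exact hb j
      _ = C ^ (s.card + 1) * (|a j - b j| + ∑ i ∈ s, |a i - b i|) := by ring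

/-- The product kernel of a bounded Hölder kernel is Hölder for the Euclidean norm. -/
theorem abs_prod_kernel_sub_le {d : ℕ} (hd : 1 ≤ d) {C C'' ε : ℝ} (hC : 0 < C) (hC'' : 0 ≤ C'')
    (hε : 0 ≤ ε) {K0 : ℝ → ℝ} (hK0nonneg : ∀ x, 0 ≤ K0 x) (hK0bdd : ∀ x, K0 x ≤ C)
    (hK0holder : ∀ x y : ℝ, |K0 x - K0 y| ≤ C'' * |x - y| ^ ε)
    (u v : EuclideanSpace ℝ (Fin d)) :
    |∏ j, K0 (u j) - ∏ j, K0 (v j)| ≤ d * C ^ (d - 1) * C'' * ‖u - v‖ ^ ε := by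
  have hsum : ∑ j, |K0 (u j) - K0 (v j)| ≤ d * (C'' * ‖u - v‖ ^ ε) := by
    calc ∑ j, |K0 (u j) - K0 (v j)| ≤ ∑ _j : Fin d, C'' * ‖u - v‖ ^ ε := by
          refine Finset.sum_le_sum fun j _ => (hK0holder _ _).trans ?_
          gcongr
          simpa using PiLp.norm_apply_le (u - v) j
      _ = d * (C'' * ‖u - v‖ ^ ε) := by simp
  have hprod := abs_prod_sub_prod_mul_le Finset.univ (fun j => K0 (u j)) (fun j => K0 (v j)) hC.le
    (fun _ => hK0nonneg _) (fun _ => hK0bdd _) (fun _ => hK0nonneg _) (fun _ => hK0bdd _)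
  rw [Finset.card_univ, Fintype.card_fin] at hprod
  refine le_of_mul_le_mul_right (hprod.trans ?_) hC
  calc C ^ d * ∑ j, |K0 (u j) - K0 (v j)| ≤ C ^ d * (d * (C'' * ‖u - v‖ ^ ε)) := by gcongr
    _ = C ^ (d - 1) * C * (d * (C'' * ‖u - v‖ ^ ε)) := by
        rw [pow_sub_one_mul (by omega)]
    _ = d * C ^ (d - 1) * C'' * ‖u - v‖ ^ ε * C := by ring

/-- Hölder continuity of the kernel regression estimate. -/
theorem kernel_estimate_holder
    (d : ℕ) (hd : 1 ≤ d) (A : ℝ) (hA : 0 < A)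
    (c C C'' ε : ℝ) (hc : 0 < c) (hC : 0 < C) (hC'' : 0 < C'') (hε0 : 0 < ε) (hε1 : ε ≤ 1)
    (K0 : ℝ → ℝ)
    (hK0nonneg : ∀ x, 0 ≤ K0 x) (hK0bdd : ∀ x, K0 x ≤ C)
    (hK0holder : ∀ x y : ℝ, |K0 x - K0 y| ≤ C'' * |x - y| ^ ε)
    (f : EuclideanSpace ℝ (Fin d) → ℝ)
    (hfnonneg : ∀ x, 0 ≤ f x) (hfbdd : ∀ x, f x ≤ c)
    (N : ℕ) (hN : 1 ≤ N)
    (Xs : Fin N → EuclideanSpace ℝ (Fin d)) (hXs : ∀ i, Xs i ∈ cube d A)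
    (h : ℝ) (hh : 0 < h) :
    ∀ x y : EuclideanSpace ℝ (Fin d),
      |kernEst d N A h K0 f Xs x - kernEst d N A h K0 f Xs y|
        ≤ c * A ^ d * d * C ^ (d - 1) * C'' * h ^ (-(d : ℝ) - ε) * ‖x - y‖ ^ ε := by
  intro x y
  have hN0 : (0 : ℝ) < N := by exact_mod_cast hN
  have hterm : ∀ i, |f (Xs i) * ∏ j, K0 ((h⁻¹ • (Xs i - x)) j)
      - f (Xs i) * ∏ j, K0 ((h⁻¹ • (Xs i - y)) j)|
      ≤ c * (d * C ^ (d - 1) * C'' * (h⁻¹ * ‖x - y‖) ^ ε) := by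
    intro i
    have hnorm : ‖h⁻¹ • (Xs i - x) - h⁻¹ • (Xs i - y)‖ = h⁻¹ * ‖x - y‖ := by
      rw [← smul_sub, sub_sub_sub_cancel_left, norm_smul, norm_sub_rev,
        Real.norm_of_nonneg (inv_nonneg.2 hh.le)]
    rw [← mul_sub, abs_mul, abs_of_nonneg (hfnonneg _), ← hnorm]
    exact mul_le_mul (hfbdd _)
      (abs_prod_kernel_sub_le hd hC hC''.le hε0.le hK0nonneg hK0bdd hK0holder _ _)
      (abs_nonneg _) hc.le
  have hpow : h ^ (-(d : ℝ) - ε) = (h ^ d)⁻¹ * h⁻¹ ^ ε := by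
    rw [sub_eq_add_neg, Real.rpow_add hh, Real.rpow_neg hh.le, Real.rpow_natCast,
      Real.rpow_neg hh.le, Real.inv_rpow hh.le]
  unfold kernEst
  rw [← mul_sub, ← Finset.sum_sub_distrib, abs_mul,
    abs_of_nonneg (by positivity : 0 ≤ A ^ d / (N * h ^ d))]
  calc A ^ d / (N * h ^ d) * |∑ i, (f (Xs i) * ∏ j, K0 ((h⁻¹ • (Xs i - x)) j)
          - f (Xs i) * ∏ j, K0 ((h⁻¹ • (Xs i - y)) j))|
      ≤ A ^ d / (N * h ^ d) * (N * (c * (d * C ^ (d - 1) * C'' * (h⁻¹ * ‖x - y‖) ^ ε))) := by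
        gcongr
        refine (Finset.abs_sum_le_sum_abs _ _).trans ?_
        refine (Finset.sum_le_sum fun i _ => hterm i).trans_eq ?_
        simp
    _ = c * A ^ d * d * C ^ (d - 1) * C'' * h ^ (-(d : ℝ) - ε) * ‖x - y‖ ^ ε := by
        rw [hpow, Real.mul_rpow (inv_nonneg.2 hh.le) (norm_nonneg _)]
        field_simp
end
end

section
/- Let f : [0,A]^d → ℝ be nonnegative and integrable with m = ∫_{[0,A]^d} f(x) dx > 0, and let f̂ : [0,A]^d → ℝ, r > 0, c_N ≥ 0 and S ∈ ℝ satisfy: (i) |f̂(x) − f(x)| ≤ r/A^d for all x ∈ [0,A]^d; (ii) |S − m| ≤ c_N; (iii) c_N ≤ r and m ≥ 8r. Then the pliable proposal ĝ*(x) = (f̂(x) + r/A^d)/(S + r) satisfies ĝ*(x) ≥ (f(x)/m)(1 − 4r/m) for all x ∈ [0,A]^d. -/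
open MeasureTheory

noncomputable section

/-- lower bound on the pliable proposal. -/
theorem pliable_proposal_lower_bound
    (d : ℕ) (hd : 1 ≤ d) (A : ℝ) (hA : 0 < A)
    (f fhat : EuclideanSpace ℝ (Fin d) → ℝ)
    (hf0 : ∀ x ∈ cube d A, 0 ≤ f x)
    (hfint : IntegrableOn f (cube d A))
    (m : ℝ) (hm : m = ∫ x in cube d A, f x) (hmpos : 0 < m)
    (r cN S : ℝ) (hr : 0 < r) (hcN : 0 ≤ cN)
    (h1 : ∀ x ∈ cube d A, |fhat x - f x| ≤ r / A ^ d)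
    (h2 : |S - m| ≤ cN) (h3 : cN ≤ r) (h4 : 8 * r ≤ m) :
    ∀ x ∈ cube d A,
      (f x / m) * (1 - 4 * r / m) ≤ (fhat x + r / A ^ d) / (S + r) := by
  intro x hx
  have hfx := hf0 x hx
  have hnum : f x ≤ fhat x + r / A ^ d := by linarith [(abs_le.mp (h1 x hx)).1]
  obtain ⟨hSl, hSu⟩ := abs_le.mp h2
  have hden : 0 < S + r := by linarith
  have hfactor : (1 - 4 * r / m) / m ≤ 1 / (m + 2 * r) := by
    rw [div_le_div_iff₀ hmpos (by positivity), one_sub_div hmpos.ne', div_mul_eq_mul_div,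
      div_le_iff₀ hmpos]
    nlinarith [mul_pos hmpos hr, mul_pos hr hr]
  calc
    f x / m * (1 - 4 * r / m) = f x * ((1 - 4 * r / m) / m) := by ring
    _ ≤ f x * (1 / (m + 2 * r)) := by gcongr
    _ = f x / (m + 2 * r) := mul_one_div _ _
    _ ≤ f x / (S + r) := div_le_div_of_nonneg_left hfx hden (by linarith)
    _ ≤ (fhat x + r / A ^ d) / (S + r) := by gcongr
end
end

section
/- Let f : [0,A]^d → ℝ be nonnegative and integrable with m = ∫_{[0,A]^d} f(x) dx > 0, and let f̂ : [0,A]^d → ℝ, r > 0, c_N ≥ 0 and S ∈ ℝ satisfy: (i) |f̂(x) − f(x)| ≤ r/A^d for all x ∈ [0,A]^d; (ii) |S − m| ≤ c_N; (iii) c_N ≤ r and m ≥ 8r. Then the envelope property holds: for all x ∈ [0,A]^d, f(x)/m ≤ M̂ · ĝ*(x), where ĝ*(x) = (f̂(x) + r/A^d)/(S + r) and M̂ = (S + r)/(S − 5r). In other words, M̂ is a valid rejection sampling constant for the target density f/m with proposal ĝ*. -/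
open MeasureTheory

noncomputable section

/-- the envelope property `f/m ≤ M̂ ĝ*` of the pliable proposal. -/
theorem pliable_proposal_envelope
    (d : ℕ) (hd : 1 ≤ d) (A : ℝ) (hA : 0 < A)
    (f fhat : EuclideanSpace ℝ (Fin d) → ℝ)
    (hf0 : ∀ x ∈ cube d A, 0 ≤ f x)
    (hfint : IntegrableOn f (cube d A))
    (m : ℝ) (hm : m = ∫ x in cube d A, f x) (hmpos : 0 < m)
    (r cN S : ℝ) (hr : 0 < r) (hcN : 0 ≤ cN)
    (h1 : ∀ x ∈ cube d A, |fhat x - f x| ≤ r / A ^ d)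
    (h2 : |S - m| ≤ cN) (h3 : cN ≤ r) (h4 : 8 * r ≤ m) :
    ∀ x ∈ cube d A,
      f x / m ≤ ((S + r) / (S - 5 * r)) * ((fhat x + r / A ^ d) / (S + r)) := by
  intro x hx
  obtain ⟨hS1, hS2⟩ := abs_le.mp h2
  have hlow := (abs_le.mp (h1 x hx)).1
  have hSr : S + r ≠ 0 := by linarith
  rw [div_mul_div_comm, mul_comm (S - 5 * r), mul_div_mul_left _ _ hSr]
  have hfx := hf0 x hx
  exact div_le_div₀ (by linarith) (by linarith) (by linarith) (by linarith)
end
end
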